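/- Let k be an algebraically closed field of characteristic 0 and let a, b ∈ k[u,v] be homogeneous forms of the same degree r+1 ≥ 1 with no common zeros on P^1. Then the ideal I_3 = (ax + by, x^2, xy, y^2, z^2) in k[x,y,z,u,v] defines, after inverting any point of the line x=y=z=0, a local complete intersection: at each closed point of the line x = y = z = 0 in P^4, the localized ideal is generated by 3 elements forming a regular sequence, and the local ring has length 4 over the local ring of the line (i.e. the scheme is a multiplicity-4 structure on the line). -/

import Mathlib

open MvPolynomial
set_option synthInstance.maxHeartbeats 1000000
set_option maxHeartbeats 1000000


lemma aux_third {R : Type*} [CommRing R] [IsDomain R] {y z f t : R}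
    (hz : Prime z) (hy : Prime y) (hzy : ¬ z ∣ y) (hyz : ¬ y ∣ z)
    (hJ : (Ideal.span {z, y}).IsPrime) (hf : f ∉ Ideal.span {z, y})
    (h : f * t ∈ Ideal.span {z ^ 2, y ^ 2}) : t ∈ Ideal.span {z ^ 2, y ^ 2} := by
  have key : ∀ s, f * s ∈ Ideal.span {z, y} → ∃ p q, p * z + q * y = s := fun s hs =>
    Ideal.mem_span_pair.1 ((hJ.mem_or_mem hs).resolve_left hf)
  obtain ⟨P, Q, hPQ⟩ := Ideal.mem_span_pair.1 h
  obtain ⟨α, β, rfl⟩ := key t (by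
    rw [← hPQ]; exact Ideal.mem_span_pair.2 ⟨P * z, Q * y, by ring⟩)
  obtain ⟨c, hc⟩ : z ∣ f * β - Q * y := by
    refine (hz.dvd_or_dvd (b := y) ⟨P * z - f * α, ?_⟩).resolve_right hzy
    linear_combination -hPQ
  obtain ⟨d, hd⟩ : y ∣ f * α - P * z := by
    refine (hy.dvd_or_dvd (b := z) ⟨Q * y - f * β, ?_⟩).resolve_right hyz
    linear_combination -hPQ
  obtain ⟨β₁, β₂, rfl⟩ := key β (Ideal.mem_span_pair.2 ⟨c, Q, by linear_combination -hc⟩)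
  obtain ⟨α₁, α₂, rfl⟩ := key α (Ideal.mem_span_pair.2 ⟨P, d, by linear_combination -hd⟩)
  -- t = α₁ z² + (α₂ + β₁) y z + β₂ y²
  have hA : f * (α₂ + β₁) * z * y = (P - f * α₁) * z ^ 2 + (Q - f * β₂) * y ^ 2 := by
    linear_combination -hPQ
  obtain ⟨e, he⟩ : z ∣ Q - f * β₂ := by
    refine (hz.dvd_or_dvd (b := y ^ 2) ⟨f * (α₂ + β₁) * y - (P - f * α₁) * z, ?_⟩).resolve_right
      fun h => hzy (hz.dvd_of_dvd_pow h)
    linear_combination -hA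
  obtain ⟨g, hg⟩ : y ∣ P - f * α₁ := by
    refine (hy.dvd_or_dvd (b := z ^ 2) ⟨f * (α₂ + β₁) * z - (Q - f * β₂) * y, ?_⟩).resolve_right
      fun h => hyz (hy.dvd_of_dvd_pow h)
    linear_combination -hA
  have hB : f * (α₂ + β₁) = g * z + e * y := by
    have : z * y ≠ 0 := mul_ne_zero hz.ne_zero hy.ne_zero
    apply mul_left_cancel₀ this
    linear_combination hA + z^2 * hg + y^2 * he
  obtain ⟨γ₁, γ₂, hγ⟩ := key _ (Ideal.mem_span_pair.2 ⟨g, e, hB.symm⟩)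
  refine Ideal.mem_span_pair.2 ⟨α₁ + γ₁ * y, β₂ + γ₂ * z, ?_⟩
  linear_combination z * y * hγ

lemma aux_reg {R : Type*} [CommRing R] [IsDomain R] {y z f : R}
    (hz : Prime z) (hy : Prime y) (hzy : ¬ z ∣ y) (hyz : ¬ y ∣ z)
    (hJ : (Ideal.span {z, y}).IsPrime) (hf : f ∉ Ideal.span {z, y}) :
    RingTheory.Sequence.IsWeaklyRegular R [z ^ 2, y ^ 2, f] := by
  rw [RingTheory.Sequence.isWeaklyRegular_iff]
  intro i hi
  rw [isSMulRegular_quotient_iff_mem_of_smul_mem]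
  simp only [List.length_cons, List.length_nil] at hi
  interval_cases i
  · intro t ht
    simpa [hz.ne_zero] using ht
  · intro t ht
    simp [Ideal.mem_span_singleton] at ht ⊢
    exact hz.pow_dvd_of_dvd_mul_left 2 (fun h => hzy (hz.dvd_of_dvd_pow h)) ht
  · intro t ht
    simp [← Ideal.span_insert] at ht ⊢
    exact aux_third hz hy hzy hyz hJ hf ht

lemma aux_span {L : Type*} [CommRing L] (A B x y z : L) (hA : IsUnit A) :
    Ideal.span {A * x + B * y, x ^ 2, x * y, y ^ 2, z ^ 2} =
      Ideal.span {z ^ 2, y ^ 2, A * x + B * y} := by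
  obtain ⟨A', hA'⟩ := hA.exists_left_inv
  set I := Ideal.span {z ^ 2, y ^ 2, A * x + B * y} with hI
  have h1 : z ^ 2 ∈ I := Ideal.subset_span (by simp)
  have h2 : y ^ 2 ∈ I := Ideal.subset_span (by simp)
  have h3 : A * x + B * y ∈ I := Ideal.subset_span (by simp)
  have h4 : x * y ∈ I := by
    have : x * y = A' * y * (A * x + B * y) - A' * B * y ^ 2 := by
      linear_combination (-x * y) * hA'
    rw [this]
    exact sub_mem (I.mul_mem_left _ h3) (I.mul_mem_left _ h2)
  have h5 : x ^ 2 ∈ I := by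
    have : x ^ 2 = A' * x * (A * x + B * y) - A' * B * (x * y) := by
      linear_combination (-x ^ 2) * hA'
    rw [this]
    exact sub_mem (I.mul_mem_left _ h3) (I.mul_mem_left _ h4)
  apply le_antisymm
  · rw [Ideal.span_le]
    rintro w (rfl | rfl | rfl | rfl | rfl) <;> assumption
  · apply Ideal.span_mono
    rintro w (rfl | rfl | rfl) <;> simp

lemma aux_prime (K : Type*) [Field K] {σ : Type*} (s : Set σ) :
    (Ideal.span ((X : σ → MvPolynomial σ K) '' s)).IsPrime := by
  classical
  let φ : MvPolynomial σ K →ₐ[K] MvPolynomial σ K := aeval fun i => if i ∈ s then 0 else X i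
  have : Ideal.span ((X : σ → MvPolynomial σ K) '' s) = RingHom.ker φ := by
    apply le_antisymm
    · rw [Ideal.span_le]
      rintro _ ⟨i, hi, rfl⟩
      simp [φ, hi]
    · intro p hp
      have : ∀ p, p - φ p ∈ Ideal.span ((X : σ → MvPolynomial σ K) '' s) := by
        intro p
        induction p using MvPolynomial.induction_on with
        | C a => simp [φ]
        | add p q hp hq =>
          rw [map_add, add_sub_add_comm]; exact add_mem hp hq
        | mul_X p i hp =>
          by_cases hi : i ∈ s
          · have : φ (X i) = 0 := by simp [φ, hi]
            rw [map_mul, this, mul_zero, sub_zero]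
            exact Ideal.mul_mem_left _ _ (Ideal.subset_span ⟨i, hi, rfl⟩)
          · have : φ (X i) = X i := by simp [φ, hi]
            rw [map_mul, this, ← sub_mul]
            exact Ideal.mul_mem_right _ _ hp
      have h := this p
      rw [RingHom.mem_ker.1 hp, sub_zero] at h
      exact h
  rw [this]
  exact RingHom.ker_isPrime _

lemma aux_X (K : Type*) [Field K] (i : Fin 5) : Prime (X i : MvPolynomial (Fin 5) K) := by
  have := aux_prime K {i}
  rw [Set.image_singleton] at this
  exact (Ideal.span_singleton_prime (X_ne_zero i)).1 this

lemma aux_eval {K : Type*} [Field K] (w : Fin 5 → K) (a : MvPolynomial (Fin 2) K) :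
    eval w (rename (![3, 4] : Fin 2 → Fin 5) a) = eval ![w 3, w 4] a := by
  rw [eval_rename]
  congr 2
  ext i; fin_cases i <;> rfl

lemma aux_m {K : Type*} [Field K] {u₀ v₀ : K} (p : MvPolynomial (Fin 5) K)
    (hp : p ∈ Ideal.span {(X 0 : MvPolynomial (Fin 5) K), X 1, X 2, X 3 - C u₀, X 4 - C v₀}) :
    eval ![0, 0, 0, u₀, v₀] p = 0 := by
  have : Ideal.span {(X 0 : MvPolynomial (Fin 5) K), X 1, X 2, X 3 - C u₀, X 4 - C v₀} ≤
      RingHom.ker (eval ![0, 0, 0, u₀, v₀]) := by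
    rw [Ideal.span_le]
    rintro w (rfl | rfl | rfl | rfl | rfl) <;> simp
  exact this hp

/-- The regular sequence, for one of the two variables `X i`, `X j` with unit coefficient. -/
lemma aux_lci {K : Type*} [Field K] (A B : MvPolynomial (Fin 2) K) (i j : Fin 5)
    (hij : i ≠ j) (hi : i = 0 ∨ i = 1) (hj : j = 0 ∨ j = 1)
    (u₀ v₀ : K) (hA : eval ![u₀, v₀] A ≠ 0)
    (m : Ideal (MvPolynomial (Fin 5) K)) [m.IsMaximal]
    (hm : m = Ideal.span {(X 0 : MvPolynomial (Fin 5) K), X 1, X 2, X 3 - C u₀, X 4 - C v₀}) :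
    ∃ g : Fin 3 → Localization.AtPrime m,
      Ideal.map (algebraMap (MvPolynomial (Fin 5) K) (Localization.AtPrime m)) (Ideal.span
      {rename (![3, 4] : Fin 2 → Fin 5) A * X i + rename (![3, 4] : Fin 2 → Fin 5) B * X j,
       X i ^ 2, X i * X j, X j ^ 2, X 2 ^ 2}) =
        Ideal.span (Set.range g) ∧
      RingTheory.Sequence.IsRegular (Localization.AtPrime m) [g 0, g 1, g 2] := by
  set f := rename (![3, 4] : Fin 2 → Fin 5) A * X i + rename (![3, 4] : Fin 2 → Fin 5) B * X j
    with hf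
  let φ := algebraMap (MvPolynomial (Fin 5) K) (Localization.AtPrime m)
  have h2j : (2 : Fin 5) ≠ j := by rcases hj with rfl | rfl <;> decide
  have h2i : (2 : Fin 5) ≠ i := by rcases hi with rfl | rfl <;> decide
  have h3i : (3 : Fin 5) ≠ i := by rcases hi with rfl | rfl <;> decide
  have h4i : (4 : Fin 5) ≠ i := by rcases hi with rfl | rfl <;> decide
  have him : (X i : MvPolynomial (Fin 5) K) ∈ m := by
    rw [hm]; rcases hi with rfl | rfl <;> exact Ideal.subset_span (by simp)
  have hjm : (X j : MvPolynomial (Fin 5) K) ∈ m := by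
    rw [hm]; rcases hj with rfl | rfl <;> exact Ideal.subset_span (by simp)
  have hzm : (X 2 : MvPolynomial (Fin 5) K) ∈ m := by
    rw [hm]; exact Ideal.subset_span (by simp)
  have hreg : RingTheory.Sequence.IsWeaklyRegular (MvPolynomial (Fin 5) K)
      [X 2 ^ 2, X j ^ 2, f] := by
    refine aux_reg (aux_X K 2) (aux_X K j) ?_ ?_ ?_ ?_
    · rw [X_dvd_X]; exact h2j
    · rw [X_dvd_X]; exact h2j.symm
    · have := aux_prime K {(2 : Fin 5), j}
      rwa [Set.image_pair] at this
    · intro h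
      obtain ⟨p, q, hpq⟩ := Ideal.mem_span_pair.1 h
      let w : Fin 5 → K := fun l => if l = i then 1 else if l = 3 then u₀ else if l = 4 then v₀ else 0
      have := congrArg (eval w) hpq
      have hw3 : w 3 = u₀ := by simp [w, h3i]
      have hw4 : w 4 = v₀ := by simp [w, h4i]
      have hw2 : w 2 = 0 := by simp [w, h2i]
      have hwi : w i = 1 := by simp [w]
      have hwj : w j = 0 := by rcases hj with rfl | rfl <;> simp [w, hij.symm]
      simp only [hf, map_add, map_mul, eval_X, aux_eval, hw3, hw4, hw2, hwi, hwj] at this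
      apply hA
      simpa using this.symm
  have hreg' := hreg.isRegular_of_isLocalization_of_mem (Localization.AtPrime m) m (by
    simp only [List.mem_cons, List.not_mem_nil, or_false]
    rintro _ (rfl | rfl | rfl)
    · exact m.pow_mem_of_mem hzm 2 (by norm_num)
    · exact m.pow_mem_of_mem hjm 2 (by norm_num)
    · exact add_mem (m.mul_mem_left _ him) (m.mul_mem_left _ hjm))
  refine ⟨![φ (X 2 ^ 2), φ (X j ^ 2), φ f], ?_, hreg'⟩
  have hu : IsUnit (φ (rename (![3, 4] : Fin 2 → Fin 5) A)) := by
    apply IsLocalization.map_units (M := m.primeCompl) (Localization.AtPrime m)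
      (⟨_, ?_⟩ : m.primeCompl)
    intro h
    rw [hm] at h
    have := aux_m _ h
    rw [aux_eval] at this
    exact hA this
  have := aux_span _ (φ (rename (![3, 4] : Fin 2 → Fin 5) B)) (φ (X i)) (φ (X j)) (φ (X 2)) hu
  rw [Ideal.map_span]
  convert! this using 2
  · simp [Set.image_insert_eq, hf, φ]
  · rw [Matrix.range_cons, Matrix.range_cons, Matrix.range_cons, Matrix.range_empty]
    simp only [hf, φ, map_add, map_mul, map_pow, Set.union_empty, Set.singleton_union]

lemma aux_finrank_dual (K : Type*) [Field K] :
    Module.finrank K (DualNumber (DualNumber K)) = 4 := by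
  have h1 : Module.finrank K (DualNumber K) = 2 := by
    change Module.finrank K (K × K) = 2
    simp
  have : Module.Finite K (DualNumber K) := Module.finite_of_finrank_pos (by omega)
  change Module.finrank K (DualNumber K × DualNumber K) = 4
  rw [Module.finrank_prod, h1]

lemma aux_ren {K : Type*} [Field K] {u₀ v₀ : K} {S : Type*} [CommRing S] [Algebra K S]
    (χ : MvPolynomial (Fin 5) K →ₐ[K] S)
    (h3 : χ (X 3) = algebraMap K S u₀) (h4 : χ (X 4) = algebraMap K S v₀)
    (p : MvPolynomial (Fin 2) K) : χ (rename (![3, 4] : Fin 2 → Fin 5) p) =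
        algebraMap K S (eval ![u₀, v₀] p) := by
  induction p using MvPolynomial.induction_on with
  | C c => simp
  | add p q hp hq => simp [hp, hq]
  | mul_X p i hp =>
    rw [map_mul, map_mul, hp, map_mul, map_mul, rename_X]
    congr 1
    fin_cases i
    · simpa using h3
    · simpa using h4

lemma aux_dim_le {K Q : Type*} [Field K] [CommRing Q] [Algebra K Q] (q w z : Q)
    (π : MvPolynomial (Fin 5) K →ₐ[K] Q) (hπ : Function.Surjective π)
    (α β u₀ v₀ : K) (hw : w * w = 0) (hz : z * z = 0)
    (h0 : π (X 0) = β • w) (h1 : π (X 1) = (-α) • w) (h2 : π (X 2) = z)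
    (h3 : π (X 3) = algebraMap K Q u₀) (h4 : π (X 4) = algebraMap K Q v₀) :
    ∃ c : Fin 4 → K, q = c 0 • 1 + c 1 • w + c 2 • z + c 3 • (w * z) := by
  obtain ⟨p, rfl⟩ := hπ q
  induction p using MvPolynomial.induction_on with
  | C c => exact ⟨![c, 0, 0, 0], by simp [Algebra.smul_def]⟩
  | add p p' hp hp' =>
    obtain ⟨c, hc⟩ := hp
    obtain ⟨c', hc'⟩ := hp'
    refine ⟨c + c', ?_⟩
    rw [map_add, hc, hc']
    simp only [Pi.add_apply, add_smul]
    ring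
  | mul_X p i hp =>
    obtain ⟨c, hc⟩ := hp
    have hmw : ∀ t : K, π p * t • w =
        (0 : K) • 1 + (t * c 0) • w + (0 : K) • z + (t * c 2) • (w * z) := by
      intro t
      rw [hc]
      simp only [Algebra.smul_def, map_mul, map_zero]
      linear_combination
        (algebraMap K Q t * (algebraMap K Q (c 1) + algebraMap K Q (c 3) * z)) * hw
    have hmK : ∀ t : K, π p * algebraMap K Q t =
        (t * c 0) • 1 + (t * c 1) • w + (t * c 2) • z + (t * c 3) • (w * z) := by
      intro t
      rw [hc]
      simp only [Algebra.smul_def, map_mul]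
      ring
    rw [map_mul]
    fin_cases i
    · exact ⟨![0, β * c 0, 0, β * c 2], by
        change π p * π (X 0) = _
        rw [h0]; exact hmw β⟩
    · exact ⟨![0, -α * c 0, 0, -α * c 2], by
        change π p * π (X 1) = _
        rw [h1]; exact hmw (-α)⟩
    · refine ⟨![0, 0, c 0, c 1], ?_⟩
      change π p * π (X 2) = (0 : K) • 1 + (0 : K) • w + c 0 • z + c 1 • (w * z)
      rw [h2, hc]
      simp only [Algebra.smul_def, map_zero]
      linear_combination (algebraMap K Q (c 2) + algebraMap K Q (c 3) * w) * hz
    · exact ⟨![u₀ * c 0, u₀ * c 1, u₀ * c 2, u₀ * c 3], by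
        change π p * π (X 3) = _
        rw [h3]; exact hmK u₀⟩
    · exact ⟨![v₀ * c 0, v₀ * c 1, v₀ * c 2, v₀ * c 3], by
        change π p * π (X 4) = _
        rw [h4]; exact hmK v₀⟩

lemma aux_dim {K : Type*} [Field K] (a b : MvPolynomial (Fin 2) K) (u₀ v₀ : K)
    (h : eval ![u₀, v₀] a ≠ 0 ∨ eval ![u₀, v₀] b ≠ 0)
    (J : Ideal (MvPolynomial (Fin 5) K))
    (hJ : J = Ideal.span
      {rename (![3, 4] : Fin 2 → Fin 5) a * X 0 + rename (![3, 4] : Fin 2 → Fin 5) b * X 1,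
       X 0 ^ 2, X 0 * X 1, X 1 ^ 2, X 2 ^ 2} ⊔
        Ideal.span {(X 3 : MvPolynomial (Fin 5) K) - C u₀, X 4 - C v₀})
    {D : Type*} [CommRing D] [Algebra K D] (hD : Module.finrank K D = 4) (e₁ e₂ : D)
    (he₁ : e₁ * e₁ = 0) (he₂ : e₂ * e₂ = 0)
    (hs : ∀ d : D, ∃ c : Fin 4 → K, d = c 0 • 1 + c 1 • e₁ + c 2 • e₂ + c 3 • (e₁ * e₂)) :
    Module.finrank K (MvPolynomial (Fin 5) K ⧸ J) = 4 := by
  set α := eval ![u₀, v₀] a with hα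
  set β := eval ![u₀, v₀] b with hβ
  let ψ : MvPolynomial (Fin 5) K →ₐ[K] D :=
    aeval ![β • e₁, (-α) • e₁, e₂, algebraMap K D u₀, algebraMap K D v₀]
  have hψ0 : ψ (X 0) = β • e₁ := by simp [ψ]
  have hψ1 : ψ (X 1) = (-α) • e₁ := by simp [ψ]
  have hψ2 : ψ (X 2) = e₂ := by simp [ψ]
  have hψ3 : ψ (X 3) = algebraMap K D u₀ := by simp [ψ]
  have hψ4 : ψ (X 4) = algebraMap K D v₀ := by simp [ψ]
  have hker : ∀ p ∈ J, ψ p = 0 := by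
    have : J ≤ RingHom.ker ψ := by
      rw [hJ, sup_le_iff, Ideal.span_le, Ideal.span_le]
      constructor
      · rintro w (rfl | rfl | rfl | rfl | rfl) <;>
          simp only [SetLike.mem_coe, RingHom.mem_ker, map_add, map_mul, map_pow,
            aux_ren ψ hψ3 hψ4, hψ0, hψ1, hψ2, ← hα, ← hβ]
        · rw [← Algebra.smul_def, ← Algebra.smul_def, smul_smul, smul_smul, ← add_smul]
          rw [show α * β + β * -α = 0 by ring, zero_smul]
        · rw [pow_two, smul_mul_smul_comm, he₁, smul_zero]
        · rw [smul_mul_smul_comm, he₁, smul_zero]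
        · rw [pow_two, smul_mul_smul_comm, he₁, smul_zero]
        · rw [pow_two, he₂]
      · rintro w (rfl | rfl) <;>
          simp only [SetLike.mem_coe, RingHom.mem_ker, map_sub, hψ3, hψ4, algHom_C, sub_self]
    exact this
  let Ψ : (MvPolynomial (Fin 5) K ⧸ J) →ₐ[K] D := Ideal.Quotient.liftₐ J ψ hker
  let π : MvPolynomial (Fin 5) K →ₐ[K] (MvPolynomial (Fin 5) K ⧸ J) := Ideal.Quotient.mkₐ K J
  have hΨ : ∀ p, Ψ (π p) = ψ p := fun p => rfl
  have hπ : Function.Surjective π := Ideal.Quotient.mkₐ_surjective K J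
  have hπ0 : ∀ p ∈ J, π p = 0 := fun p hp => Ideal.Quotient.eq_zero_iff_mem.2 hp
  have hJ1 : ∀ p ∈ ({rename (![3, 4] : Fin 2 → Fin 5) a * X 0 +
      rename (![3, 4] : Fin 2 → Fin 5) b * X 1,
       X 0 ^ 2, X 0 * X 1, X 1 ^ 2, X 2 ^ 2} : Set (MvPolynomial (Fin 5) K)), π p = 0 :=
    fun p hp => hπ0 p (hJ ▸ Ideal.mem_sup_left (Ideal.subset_span hp))
  have hJ2 : ∀ p ∈ ({X 3 - C u₀, X 4 - C v₀} : Set (MvPolynomial (Fin 5) K)), π p = 0 :=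
    fun p hp => hπ0 p (hJ ▸ Ideal.mem_sup_right (Ideal.subset_span hp))
  have h3 : π (X 3) = algebraMap K _ u₀ := by
    have := hJ2 (X 3 - C u₀) (by simp)
    rwa [map_sub, algHom_C, sub_eq_zero] at this
  have h4 : π (X 4) = algebraMap K _ v₀ := by
    have := hJ2 (X 4 - C v₀) (by simp)
    rwa [map_sub, algHom_C, sub_eq_zero] at this
  have hlin : α • π (X 0) + β • π (X 1) = 0 := by
    have := hJ1 _ (Set.mem_insert _ _)
    rwa [map_add, map_mul, map_mul, aux_ren π h3 h4, aux_ren π h3 h4, ← Algebra.smul_def,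
      ← Algebra.smul_def] at this
  have hxx : π (X 0) * π (X 0) = 0 := by
    rw [← map_mul, ← pow_two]; exact hJ1 _ (by simp)
  have hyy : π (X 1) * π (X 1) = 0 := by
    rw [← map_mul, ← pow_two]; exact hJ1 _ (by simp)
  have hzz : π (X 2) * π (X 2) = 0 := by
    rw [← map_mul, ← pow_two]; exact hJ1 _ (by simp)
  obtain ⟨w, hx, hy, hww, hΨw⟩ : ∃ w, π (X 0) = β • w ∧ π (X 1) = (-α) • w ∧ w * w = 0 ∧
      Ψ w = e₁ := by
    by_cases hα0 : α = 0
    · have hβ0 : β ≠ 0 := h.resolve_left (fun h => h hα0)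
      refine ⟨β⁻¹ • π (X 0), ?_, ?_, ?_, ?_⟩
      · rw [smul_smul, mul_inv_cancel₀ hβ0, one_smul]
      · rw [hα0, zero_smul, zero_add] at hlin
        rw [hα0, neg_zero, zero_smul]
        exact (smul_eq_zero.1 hlin).resolve_left hβ0
      · rw [smul_mul_smul_comm, hxx, smul_zero]
      · rw [map_smul, hΨ, hψ0, smul_smul, inv_mul_cancel₀ hβ0, one_smul]
    · refine ⟨(-α)⁻¹ • π (X 1), ?_, ?_, ?_, ?_⟩
      · have : α • (π (X 0) - β • (-α)⁻¹ • π (X 1)) = 0 := by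
          rw [smul_sub, smul_smul, smul_smul,
            show α * β * (-α)⁻¹ = -β by field_simp, neg_smul, sub_neg_eq_add, hlin]
        exact sub_eq_zero.1 ((smul_eq_zero.1 this).resolve_left hα0)
      · rw [smul_smul, mul_inv_cancel₀ (neg_ne_zero.2 hα0), one_smul]
      · rw [smul_mul_smul_comm, hyy, smul_zero]
      · rw [map_smul, hΨ, hψ1, smul_smul, inv_mul_cancel₀ (neg_ne_zero.2 hα0), one_smul]
  have hspan : Submodule.span K (Set.range ![1, w, π (X 2), w * π (X 2)]) = ⊤ := by
    rw [eq_top_iff]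
    intro q _
    obtain ⟨c, hc⟩ := aux_dim_le q w (π (X 2)) π hπ α β u₀ v₀ hww hzz hx hy rfl h3 h4
    rw [Submodule.mem_span_range_iff_exists_fun]
    exact ⟨c, by rw [hc, Fin.sum_univ_four]; rfl⟩
  have hfin : Module.Finite K (MvPolynomial (Fin 5) K ⧸ J) :=
    ⟨⟨(Set.finite_range ![1, w, π (X 2), w * π (X 2)]).toFinset, by simpa using hspan⟩⟩
  apply le_antisymm
  · rw [← finrank_top, ← hspan]
    exact (finrank_range_le_card _).trans (by simp)
  · rw [← hD]
    apply LinearMap.finrank_le_finrank_of_surjective (f := Ψ.toLinearMap)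
    intro d
    obtain ⟨c, rfl⟩ := hs d
    refine ⟨c 0 • 1 + c 1 • w + c 2 • π (X 2) + c 3 • (w * π (X 2)), ?_⟩
    simp only [AlgHom.toLinearMap_apply, map_add, map_smul, map_mul, map_one, hΨw, hΨ, hψ2]

lemma aux_dim' {K : Type*} [Field K] (a b : MvPolynomial (Fin 2) K) (u₀ v₀ : K)
    (h : eval ![u₀, v₀] a ≠ 0 ∨ eval ![u₀, v₀] b ≠ 0)
    (J : Ideal (MvPolynomial (Fin 5) K))
    (hJ : J = Ideal.span
      {rename (![3, 4] : Fin 2 → Fin 5) a * X 0 + rename (![3, 4] : Fin 2 → Fin 5) b * X 1,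
       X 0 ^ 2, X 0 * X 1, X 1 ^ 2, X 2 ^ 2} ⊔
        Ideal.span {(X 3 : MvPolynomial (Fin 5) K) - C u₀, X 4 - C v₀}) :
    Module.finrank K (MvPolynomial (Fin 5) K ⧸ J) = 4 := by
  refine aux_dim a b u₀ v₀ h J hJ (aux_finrank_dual K)
    (TrivSqZeroExt.inl (DualNumber.eps : DualNumber K)) DualNumber.eps ?_ ?_ ?_
  · rw [← TrivSqZeroExt.inl_mul, DualNumber.eps_mul_eps, TrivSqZeroExt.inl_zero]
  · exact DualNumber.eps_mul_eps
  · intro d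
    refine ⟨![d.fst.fst, d.fst.snd, d.snd.fst, d.snd.snd], ?_⟩
    refine TrivSqZeroExt.ext (TrivSqZeroExt.ext ?_ ?_) (TrivSqZeroExt.ext ?_ ?_) <;> simp

/-- Let `a, b ∈ K[u,v]` be forms of degree `r+1` without common zeros, and
`I₃ = (ax + by, x², xy, y², z²)` in `K[x,y,z,u,v]`. At each closed point of the line
`x = y = z = 0` (with maximal ideal `m`), the localized ideal is generated by 3 elements
forming a regular sequence (a local complete intersection), and the transverse Artinian
fiber has `K`-dimension 4: a multiplicity-4 structure on the line. -/
theorem stmt9 (K : Type*) [Field K] [IsAlgClosed K] [CharZero K]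
    (r : ℕ) (a b : MvPolynomial (Fin 2) K)
    (ha : a.IsHomogeneous (r + 1)) (hb : b.IsHomogeneous (r + 1))
    (hab : ∀ p : Fin 2 → K, p ≠ 0 → (eval p a ≠ 0 ∨ eval p b ≠ 0))
    (I₃ : Ideal (MvPolynomial (Fin 5) K))
    (hI₃ : I₃ = Ideal.span
      {rename (![3, 4] : Fin 2 → Fin 5) a * X 0 + rename (![3, 4] : Fin 2 → Fin 5) b * X 1,
       X 0 ^ 2, X 0 * X 1, X 1 ^ 2, X 2 ^ 2})
    (u₀ v₀ : K) (hp : ¬(u₀ = 0 ∧ v₀ = 0))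
    (m : Ideal (MvPolynomial (Fin 5) K)) [m.IsMaximal]
    (hm : m = Ideal.span {(X 0 : MvPolynomial (Fin 5) K), X 1, X 2, X 3 - C u₀, X 4 - C v₀}) :
    (∃ g : Fin 3 → Localization.AtPrime m,
      Ideal.map (algebraMap (MvPolynomial (Fin 5) K) (Localization.AtPrime m)) I₃ =
        Ideal.span (Set.range g) ∧
      RingTheory.Sequence.IsRegular (Localization.AtPrime m) [g 0, g 1, g 2]) ∧
    Module.finrank K
      (MvPolynomial (Fin 5) K ⧸
        (I₃ ⊔ Ideal.span {(X 3 : MvPolynomial (Fin 5) K) - C u₀, X 4 - C v₀})) = 4 := by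
  subst hI₃
  have hp' : (![u₀, v₀] : Fin 2 → K) ≠ 0 := by
    intro h
    exact hp ⟨congrFun h 0, congrFun h 1⟩
  have hab' := hab _ hp'
  refine ⟨?_, aux_dim' a b u₀ v₀ hab' _ rfl⟩
  rcases hab' with h | h
  · exact aux_lci a b 0 1 (by decide) (by simp) (by simp) u₀ v₀ h m hm
  · have := aux_lci b a 1 0 (by decide) (by simp) (by simp) u₀ v₀ h m hm
    convert! this using 6
    ext t
    simp only [Set.mem_insert_iff, Set.mem_singleton_iff, add_comm,
      mul_comm (X 1 : MvPolynomial (Fin 5) K) (X 0)]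
    tauto
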